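/- arXiv:1912.00406 — 2 statements merged into one kernel-verified Lean document; each statement's English description precedes it below -/
import Mathlib

section
/- For 0 < u < v, ∫_u^v x^{-1} e^x Ei(-x) dx = Ei(-v)Ei(v) − Ei(-u)Ei(u) + (1/2)(Ei²(-u) − Ei²(-v)) + ∑_{m=0}^∞ ∑_{l=0}^{2m} 2(v^l e^{-v} − u^l e^{-u}) / ((2m+1)² · l!). -/
open Real MeasureTheory

/-- The exponential integral at negative argument: `Ei(-x) = -∫_x^∞ e^{-t}/t dt`. -/
noncomputable def EiNeg (x : ℝ) : ℝ := -∫ t in Set.Ioi x, Real.exp (-t) / t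

/-- The exponential integral for positive arguments (principal value), via its
series expansion `Ei(x) = γ + ln x + ∑_{n≥1} x^n/(n·n!)`. -/
noncomputable def EiPos (x : ℝ) : ℝ :=
  Real.eulerMascheroniConstant + Real.log x +
    ∑' n : ℕ, x ^ (n + 1) / ((n + 1) * ((n + 1).factorial : ℝ))


open Set Filter Topology

theorem aux_log_int : IntegrableOn (fun t : ℝ => Real.log t * Real.exp (-t)) (Ioi 0) ∧
    ∫ t in Ioi (0:ℝ), Real.log t * Real.exp (-t) = -Real.eulerMascheroniConstant := by
  have key : MellinConvergent (fun t : ℝ => Real.log t • ((Real.exp (-t) : ℝ) : ℂ)) 1 := by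
    refine (mellin_hasDerivAt_of_isBigO_rpow (E := ℂ) (a := 2) (b := 0) ?_ ?_ ?_ ?_ ?_).1
    · refine (Continuous.continuousOn ?_).locallyIntegrableOn measurableSet_Ioi
      exact Complex.continuous_ofReal.comp (Real.continuous_exp.comp continuous_neg)
    · rw [← Asymptotics.isBigO_norm_left]
      simp_rw [Complex.norm_real, Asymptotics.isBigO_norm_left]
      simpa only [neg_one_mul] using (isLittleO_exp_neg_mul_rpow_atTop zero_lt_one _).isBigO
    · simp
    · simp_rw [neg_zero, Real.rpow_zero]
      refine Asymptotics.isBigO_const_of_tendsto (?_ : Tendsto _ _ (𝓝 (1 : ℂ))) one_ne_zero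
      rw [(by simp : (1 : ℂ) = Real.exp (-0))]
      exact (Complex.continuous_ofReal.comp
        (Real.continuous_exp.comp continuous_neg)).continuousWithinAt
    · simp
  have h1 : IntegrableOn (fun t : ℝ => ((Real.log t * Real.exp (-t) : ℝ) : ℂ)) (Ioi 0) := by
    refine IntegrableOn.congr_fun key (fun t _ => ?_) measurableSet_Ioi
    simp
  refine ⟨?_, ?_⟩
  · have := h1.re
    simp only [RCLike.re_to_complex, Complex.ofReal_re] at this
    exact this
  · have hd := Complex.hasDerivAt_GammaIntegral (s := 1) (by simp)
    have hd2 : HasDerivAt Complex.Gamma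
        (∫ t : ℝ in Ioi 0, (t:ℂ) ^ ((1:ℂ) - 1) * (Real.log t * Real.exp (-t))) 1 := by
      refine hd.congr_of_eventuallyEq ?_
      have : IsOpen {s : ℂ | 0 < s.re} := Complex.continuous_re.isOpen_preimage _ isOpen_Ioi
      filter_upwards [this.mem_nhds (by simp : (1:ℂ) ∈ {s : ℂ | 0 < s.re})] with a ha
      exact Complex.Gamma_eq_integral ha
    have h3 := hd2.unique Complex.hasDerivAt_Gamma_one
    have h4 : ∫ t : ℝ in Ioi 0, (t:ℂ) ^ ((1:ℂ) - 1) * (Real.log t * Real.exp (-t))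
        = ((∫ t in Ioi (0:ℝ), Real.log t * Real.exp (-t) : ℝ) : ℂ) := by
      rw [← integral_complex_ofReal]
      simp
    rw [h4] at h3
    exact_mod_cast h3

theorem aux_int {x : ℝ} (hx : 0 < x) : IntegrableOn (fun t : ℝ => Real.exp (-t) / t) (Ioi x) := by
  refine Integrable.mono' ((integrableOn_exp_neg_Ioi x).const_mul x⁻¹) ?_ ?_
  · exact (by fun_prop : Measurable (fun t : ℝ => Real.exp (-t) / t)).aestronglyMeasurable
  · refine (ae_restrict_iff' measurableSet_Ioi).2 (Eventually.of_forall fun t ht => ?_)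
    have ht' : x < t := ht
    have h0 : 0 < t := hx.trans ht'
    rw [Real.norm_of_nonneg (by positivity), div_eq_inv_mul]
    gcongr

theorem aux_deriv {x : ℝ} (hx : 0 < x) : HasDerivAt EiNeg (Real.exp (-x) / x) x := by
  have hx2 : 0 < x / 2 := by positivity
  have h : HasDerivAt (fun y => -(∫ t in Ioi (x/2), Real.exp (-t) / t)
      + ∫ t in (x/2)..y, Real.exp (-t) / t) (Real.exp (-x) / x) x := by
    refine HasDerivAt.const_add _ ?_
    have hc : ∀ y ∈ Ioi (0:ℝ), ContinuousAt (fun t : ℝ => Real.exp (-t) / t) y := by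
      intro y hy
      have : y ≠ 0 := ne_of_gt hy
      fun_prop (disch := assumption)
    refine intervalIntegral.integral_hasDerivAt_right ?_ ?_ (hc x hx)
    · refine ContinuousOn.intervalIntegrable fun y hy => (hc y ?_).continuousWithinAt
      rw [uIcc_of_le (by linarith)] at hy
      exact lt_of_lt_of_le hx2 hy.1
    · exact (by fun_prop : Measurable (fun t : ℝ =>
        Real.exp (-t) / t)).stronglyMeasurable.stronglyMeasurableAtFilter
  refine h.congr_of_eventuallyEq ?_
  filter_upwards [lt_mem_nhds hx] with y hy
  rw [EiNeg, ← intervalIntegral.integral_Ioi_sub_Ioi' (aux_int hx2) (aux_int hy)]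
  ring

theorem aux_parts {x : ℝ} (hx : 0 < x) :
    EiNeg x = Real.exp (-x) * Real.log x - ∫ t in Ioi x, Real.log t * Real.exp (-t) := by
  have hl : IntegrableOn (fun t : ℝ => Real.log t * Real.exp (-t)) (Ioi x) :=
    aux_log_int.1.mono_set (Ioi_subset_Ioi hx.le)
  have hlim : Tendsto (fun t : ℝ => Real.exp (-t) * Real.log t) atTop (𝓝 0) := by
    have h1 : Tendsto (fun t : ℝ => t ^ 1 * Real.exp (-t)) atTop (𝓝 0) :=
      Real.tendsto_pow_mul_exp_neg_atTop_nhds_zero 1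
    refine squeeze_zero' ?_ ?_ h1
    · filter_upwards [eventually_ge_atTop 1] with t ht
      have := Real.log_nonneg ht
      positivity
    · filter_upwards [eventually_ge_atTop 1] with t ht
      have : Real.log t ≤ t := by
        have := Real.log_le_sub_one_of_pos (by linarith : 0 < t)
        linarith
      rw [pow_one, mul_comm t]
      gcongr
  have h := integral_Ioi_of_hasDerivAt_of_tendsto' (a := x) (m := 0)
    (f := fun t : ℝ => Real.exp (-t) * Real.log t)
    (f' := fun t => Real.exp (-t) / t - Real.log t * Real.exp (-t)) ?_ ((aux_int hx).sub hl) hlim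
  · rw [integral_sub (aux_int hx) hl] at h
    rw [EiNeg]
    linarith
  · intro t ht
    have h0 : t ≠ 0 := (hx.trans_le ht).ne'
    have := ((hasDerivAt_neg t).exp).mul (Real.hasDerivAt_log h0)
    refine this.congr_deriv ?_
    field_simp
    ring

theorem aux_lim : Tendsto (fun x => EiNeg x - Real.log x) (𝓝[>] 0)
    (𝓝 Real.eulerMascheroniConstant) := by
  have hI : Tendsto (fun x => ∫ t in Ioi x, Real.log t * Real.exp (-t)) (𝓝[>] (0:ℝ))
      (𝓝 (-Real.eulerMascheroniConstant)) := by
    rw [← aux_log_int.2]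
    exact (aux_log_int.1.continuousWithinAt_Ici_primitive_Ioi).mono_left
      (nhdsWithin_mono _ Ioi_subset_Ici_self)
  have hlg : Tendsto (fun x : ℝ => Real.log x * x) (𝓝[>] 0) (𝓝 0) := by
    simpa only [Real.rpow_one] using tendsto_log_mul_rpow_nhdsGT_zero zero_lt_one
  have h2 : Tendsto (fun x : ℝ => (Real.exp (-x) - 1) * Real.log x) (𝓝[>] 0) (𝓝 0) := by
    refine squeeze_zero_norm' (a := fun x => |Real.log x * x|) ?_ (by simpa only [abs_zero] using hlg.abs)
    filter_upwards [self_mem_nhdsWithin] with x hx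
    have hx : 0 < x := hx
    rw [norm_mul, abs_mul, mul_comm, Real.norm_eq_abs, Real.norm_eq_abs]
    refine mul_le_mul_of_nonneg_left ?_ (abs_nonneg _)
    have := Real.add_one_le_exp (-x)
    have h' : Real.exp (-x) ≤ 1 := by simpa using hx.le
    rw [abs_of_pos hx, abs_of_nonpos (by linarith)]
    linarith
  have h3 := h2.sub hI
  rw [zero_sub, neg_neg] at h3
  refine h3.congr' ?_
  filter_upwards [self_mem_nhdsWithin] with x hx
  rw [aux_parts hx]
  ring

/-- the entire part of `Ei` -/
noncomputable def Pser (x : ℝ) : ℝ :=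
    ∑' n : ℕ, x ^ (n + 1) / ((n + 1) * ((n + 1).factorial : ℝ))

theorem aux_sum (x : ℝ) :
    Summable (fun n : ℕ => x ^ (n + 1) / (((n:ℝ) + 1) * ((n + 1).factorial : ℝ))) := by
  have h := ((Real.summable_pow_div_factorial |x|).comp_injective (add_left_injective 1))
  refine Summable.of_norm_bounded h fun n => ?_
  rw [norm_div, norm_pow, Real.norm_eq_abs, Real.norm_of_nonneg (by positivity)]
  simp only [Function.comp]
  gcongr
  have : (0:ℝ) ≤ n := by positivity
  have : (0:ℝ) < ((n+1).factorial : ℝ) := by positivity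
  nlinarith

theorem aux_Pderiv {x : ℝ} (hx : x ≠ 0) : HasDerivAt Pser ((Real.exp x - 1) / x) x := by
  set R := |x| + 1 with hR
  have h := hasDerivAt_tsum_of_isPreconnected (t := Ioo (-R) R) (y := x) (y₀ := x)
    (u := fun n : ℕ => R ^ n / (n.factorial : ℝ))
    (g := fun (n : ℕ) (y : ℝ) => y ^ (n + 1) / (((n:ℝ) + 1) * ((n + 1).factorial : ℝ)))
    (g' := fun (n : ℕ) (y : ℝ) => y ^ n / ((n + 1).factorial : ℝ))
    (Real.summable_pow_div_factorial R) isOpen_Ioo isPreconnected_Ioo ?_ ?_ ?_ (aux_sum x) ?_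
  · refine h.congr_deriv ?_
    have he : HasSum (fun n : ℕ => x ^ n / (n.factorial : ℝ)) (Real.exp x) := by
      rw [Real.exp_eq_exp_ℝ]
      exact NormedSpace.expSeries_div_hasSum_exp x
    have he2 := (hasSum_nat_add_iff' 1).2 he
    have he3 := he2.div_const x
    rw [← (by simpa using he3.tsum_eq : _ = (Real.exp x - 1) / x)]
    refine tsum_congr fun n => ?_
    rw [pow_succ]
    field_simp
  · intro n y _
    refine ((hasDerivAt_pow (n+1) y).div_const _).congr_deriv ?_
    push_cast
    try simp only [add_tsub_cancel_right]
    field_simp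
  · intro n y hy
    rw [norm_div, norm_pow, Real.norm_eq_abs, Real.norm_of_nonneg (by positivity)]
    have : |y| ≤ R := (abs_lt.2 hy).le
    have h2 : n.factorial ≤ (n+1).factorial := Nat.factorial_le (by omega)
    gcongr
  · exact abs_lt.1 (by linarith)
  · exact abs_lt.1 (by linarith)

theorem aux_Pcont : Tendsto (fun x => Pser (-x)) (𝓝[>] 0) (𝓝 0) := by
  have h : ContinuousOn Pser (Icc (-1) 1) := by
    refine continuousOn_tsum (u := fun n : ℕ => (1:ℝ) ^ n / (n.factorial : ℝ)) ?_
      (Real.summable_pow_div_factorial 1) ?_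
    · intro n
      fun_prop
    · intro n y hy
      rw [norm_div, norm_pow, Real.norm_eq_abs, Real.norm_of_nonneg (by positivity)]
      have : |y| ≤ 1 := abs_le.2 hy
      have h2 : (n.factorial : ℝ) ≤ (n+1).factorial := by
        exact_mod_cast Nat.factorial_le (by omega)
      have h3 : (0:ℝ) < n.factorial := by positivity
      rw [one_pow]
      gcongr
      · exact pow_le_one₀ (abs_nonneg _) this
      · have : (0:ℝ) ≤ n := by positivity
        nlinarith
  have h1 : ContinuousAt Pser (-0) := h.continuousAt (by simpa using Icc_mem_nhds (by norm_num) (by norm_num))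
  have h0 : Pser (-0) = 0 := by simp [Pser]
  have h2 : ContinuousAt (fun x : ℝ => Pser (-x)) 0 :=
    ContinuousAt.comp (f := fun x : ℝ => -x) h1 continuous_neg.continuousAt
  have h3 := h2.tendsto.mono_left (nhdsWithin_le_nhds (s := Ioi 0))
  rwa [h0] at h3

theorem aux_EiNeg {x : ℝ} (hx : 0 < x) :
    EiNeg x = Real.eulerMascheroniConstant + Real.log x + Pser (-x) := by
  set F : ℝ → ℝ := fun y => EiNeg y - Real.log y - Pser (-y) with hF
  have hd : ∀ y ∈ Ioi (0:ℝ), HasDerivAt F 0 y := by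
    intro y hy
    have hy0 : y ≠ 0 := ne_of_gt hy
    have h1 : HasDerivAt (fun y => Pser (-y)) ((Real.exp (-y) - 1) / (-y) * (-1)) y :=
      (aux_Pderiv (neg_ne_zero.2 hy0)).comp y (hasDerivAt_neg y)
    refine (((aux_deriv hy).sub (Real.hasDerivAt_log hy0)).sub h1).congr_deriv ?_
    field_simp
    ring
  have hconst : ∀ y ∈ Ioi (0:ℝ), F y = F x := by
    intro y hy
    refine isOpen_Ioi.is_const_of_deriv_eq_zero isPreconnected_Ioi
      (fun z hz => (hd z hz).differentiableAt.differentiableWithinAt)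
      (fun z hz => (hd z hz).deriv) hy hx
  have hl : Tendsto F (𝓝[>] 0) (𝓝 (Real.eulerMascheroniConstant - 0)) :=
    aux_lim.sub aux_Pcont
  have hl2 : Tendsto F (𝓝[>] 0) (𝓝 (F x)) := by
    refine tendsto_const_nhds.congr' ?_
    filter_upwards [self_mem_nhdsWithin] with y hy
    exact (hconst y hy).symm
  have := tendsto_nhds_unique hl hl2
  simp only [hF] at this
  linarith

theorem aux_diff {x : ℝ} (hx : 0 < x) :
    EiPos x - EiNeg x =
      ∑' m : ℕ, 2 * x ^ (2 * m + 1) / (((2 * m + 1 : ℕ) : ℝ) * ((2 * m + 1).factorial : ℝ)) := by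
  have h1 : EiPos x - EiNeg x = Pser x - Pser (-x) := by
    have : EiPos x = Real.eulerMascheroniConstant + Real.log x + Pser x := rfl
    rw [aux_EiNeg hx, this]
    ring
  obtain ⟨f, hf⟩ : ∃ f : ℕ → ℝ, f = fun n : ℕ =>
      x ^ (n + 1) / (((n:ℝ) + 1) * ((n + 1).factorial : ℝ)) -
      (-x) ^ (n + 1) / (((n:ℝ) + 1) * ((n + 1).factorial : ℝ)) := ⟨_, rfl⟩
  have hs : Summable f := by rw [hf]; exact (aux_sum x).sub (aux_sum (-x))
  have h2 : Pser x - Pser (-x) = ∑' n, f n := by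
    rw [Pser, Pser, ← (aux_sum x).tsum_sub (aux_sum (-x)), hf]
  have he : ∀ m : ℕ, f (2 * m) =
      2 * x ^ (2 * m + 1) / (((2 * m + 1 : ℕ) : ℝ) * ((2 * m + 1).factorial : ℝ)) := by
    intro m
    simp only [hf]
    rw [Odd.neg_pow ⟨m, rfl⟩, Nat.cast_succ]
    ring
  have ho : ∀ m : ℕ, f (2 * m + 1) = 0 := by
    intro m
    simp only [hf]
    rw [Even.neg_pow ⟨m + 1, by ring⟩, sub_self]
  have hse : Summable (fun k : ℕ => f (2 * k)) :=
    hs.comp_injective (i := fun k : ℕ => 2 * k) (fun a b h => by simpa using h)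
  have hso : Summable (fun k : ℕ => f (2 * k + 1)) := by
    simp only [ho]
    exact summable_zero
  rw [h1, h2, ← tsum_even_add_odd hse hso]
  simp only [ho, he, tsum_zero, add_zero]

theorem aux_inner (K : ℝ) (c : ℕ → ℝ) (m : ℕ) (y : ℝ) :
    HasDerivAt (fun y : ℝ => ∑ l ∈ Finset.range (m + 1),
      2 * (y ^ l * Real.exp (-y) - c l) / (K * (l.factorial : ℝ)))
      (-(2 * Real.exp (-y) * y ^ m / (K * (m.factorial : ℝ)))) y := by
  have he : HasDerivAt (fun y : ℝ => Real.exp (-y)) (Real.exp (-y) * (-1)) y :=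
    (hasDerivAt_neg y).exp
  induction m with
  | zero =>
    simp only [zero_add, Finset.sum_range_one, pow_zero, one_mul]
    refine (((he.sub_const (c 0)).const_mul 2).div_const _).congr_deriv ?_
    ring
  | succ m ih =>
    simp_rw [Finset.sum_range_succ _ (m + 1)]
    refine (ih.add (((((hasDerivAt_pow (m+1) y).mul he).sub_const (c (m+1))).const_mul
      2).div_const (K * ((m+1).factorial : ℝ)))).congr_deriv ?_
    rw [Nat.factorial_succ]
    have h1 : ((m:ℝ) + 1) ≠ 0 := by positivity
    have h2 : (m.factorial : ℝ) ≠ 0 := by positivity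
    push_cast
    try simp only [add_tsub_cancel_right]
    by_cases hK : K = 0
    · simp [hK]
    field_simp
    ring

theorem aux_T (u : ℝ) (c : ℕ → ℝ) (hc : ∀ l, c l = u ^ l * Real.exp (-u)) {x : ℝ} (hx : 0 < x) :
    HasDerivAt (fun y : ℝ => ∑' m : ℕ, ∑ l ∈ Finset.range (2 * m + 1),
            2 * (y ^ l * Real.exp (-y) - c l) /
              (((2 * m + 1 : ℕ) : ℝ) ^ 2 * (l.factorial : ℝ)))
      (-(Real.exp (-x) / x * (EiPos x - EiNeg x))) x := by
  set R := max |x| |u| + 1 with hR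
  have hxR : |x| < R := by have := le_max_left |x| |u|; linarith
  have huR : |u| < R := by have := le_max_right |x| |u|; linarith
  have hR0 : 0 < R := (abs_nonneg _).trans_lt hxR
  have hsum : Summable (fun n : ℕ => 2 * Real.exp R * (R ^ (2 * n) / ((2 * n).factorial : ℝ))) :=
    ((Real.summable_pow_div_factorial R).comp_injective (i := fun k : ℕ => 2 * k)
      (fun a b h => by simpa using h)).mul_left _
  have h := hasDerivAt_tsum_of_isPreconnected (t := Ioo (-R) R) (y := x) (y₀ := u)
    (g := fun (m : ℕ) (y : ℝ) => ∑ l ∈ Finset.range (2 * m + 1),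
            2 * (y ^ l * Real.exp (-y) - c l) /
              (((2 * m + 1 : ℕ) : ℝ) ^ 2 * (l.factorial : ℝ)))
    (g' := fun (m : ℕ) (y : ℝ) => -(2 * Real.exp (-y) * y ^ (2 * m) /
      (((2 * m + 1 : ℕ) : ℝ) ^ 2 * ((2 * m).factorial : ℝ))))
    hsum isOpen_Ioo isPreconnected_Ioo (fun n y _ => aux_inner _ c (2 * n) y) ?_
      (abs_lt.1 huR) ?_ (abs_lt.1 hxR)
  · refine h.congr_deriv ?_
    rw [tsum_neg, aux_diff hx, ← tsum_mul_left]
    congr 1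
    refine tsum_congr fun m => ?_
    rw [Nat.factorial_succ, pow_succ]
    push_cast
    have h1 : (2 * (m:ℝ) + 1) ≠ 0 := by positivity
    have h2 : ((2 * m).factorial : ℝ) ≠ 0 := by positivity
    field_simp
    try ring
  · intro n y hy
    have hy' : |y| ≤ R := (abs_lt.2 hy).le
    have h3 : Real.exp (-y) ≤ Real.exp R := Real.exp_le_exp.2 (by linarith [hy.1])
    rw [norm_neg, norm_div, norm_mul, norm_pow, Real.norm_eq_abs y,
      Real.norm_of_nonneg (by positivity), Real.norm_of_nonneg (by positivity), mul_div_assoc]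
    have h4 : (1:ℝ) ≤ ((2 * n + 1 : ℕ) : ℝ) ^ 2 := by
      apply one_le_pow₀
      exact_mod_cast Nat.succ_le_succ (Nat.zero_le _)
    have h5 : (0:ℝ) < ((2 * n).factorial : ℝ) := by positivity
    gcongr
    nlinarith
  · simp [hc]




theorem stmt5 (u v : ℝ) (hu : 0 < u) (huv : u < v) :
    ∫ x in u..v, x⁻¹ * Real.exp x * EiNeg x =
      EiNeg v * EiPos v - EiNeg u * EiPos u
        + (1 / 2) * (EiNeg u ^ 2 - EiNeg v ^ 2)
        + ∑' m : ℕ, ∑ l ∈ Finset.range (2 * m + 1),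
            2 * (v ^ l * Real.exp (-v) - u ^ l * Real.exp (-u)) /
              (((2 * m + 1 : ℕ) : ℝ) ^ 2 * (l.factorial : ℝ)) := by
  set T : ℝ → ℝ := fun y : ℝ => ∑' m : ℕ, ∑ l ∈ Finset.range (2 * m + 1),
            2 * (y ^ l * Real.exp (-y) - u ^ l * Real.exp (-u)) /
              (((2 * m + 1 : ℕ) : ℝ) ^ 2 * (l.factorial : ℝ)) with hT
  have hTu : T u = 0 := by simp [hT]
  have hpos : ∀ x ∈ uIcc u v, 0 < x := by
    intro x hx
    rw [uIcc_of_le huv.le] at hx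
    exact hu.trans_le hx.1
  have hd : ∀ x ∈ uIcc u v, HasDerivAt
      (fun y => EiNeg y * EiPos y - (1 / 2) * EiNeg y ^ 2 + T y)
      (x⁻¹ * Real.exp x * EiNeg x) x := by
    intro x hx
    have h0 := hpos x hx
    have hT' : HasDerivAt T (-(Real.exp (-x) / x * (EiPos x - EiNeg x))) x :=
      aux_T u (fun l => u ^ l * Real.exp (-u)) (fun _ => rfl) h0
    have hP : HasDerivAt EiPos (x⁻¹ + (Real.exp x - 1) / x) x :=
      ((Real.hasDerivAt_log h0.ne').const_add _).add (aux_Pderiv h0.ne')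
    have hN := aux_deriv h0
    refine (((hN.mul hP).sub ((hN.pow 2).const_mul (1 / 2))).add hT').congr_deriv ?_
    field_simp
    ring
  rw [intervalIntegral.integral_eq_sub_of_hasDerivAt hd]
  · change _ = EiNeg v * EiPos v - EiNeg u * EiPos u
        + (1 / 2) * (EiNeg u ^ 2 - EiNeg v ^ 2) + T v
    simp only [hTu]
    ring
  · refine ContinuousOn.intervalIntegrable fun x hx => ?_
    have h0 := hpos x hx
    have := (aux_deriv h0).continuousAt
    exact (((continuousAt_inv₀ h0.ne').mul Real.continuous_exp.continuousAt).mul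
      this).continuousWithinAt
end

section
/- For 0 < u < v, ∫_u^v Ei(x) d[Ei(-x)] = ∫_u^v Ei(x)·(e^{-x}/x) dx = (1/2)(Ei²(-v) − Ei²(-u)) + ∑_{m=0}^∞ ∑_{l=0}^{2m} 2(u^l e^{-u} − v^l e^{-v}) / ((2m+1)² · l!). -/
open Real MeasureTheory

open Filter Topology

/-- The entire part of the exponential integral. -/
noncomputable def EinT (y : ℝ) : ℝ :=
  ∑' n : ℕ, y ^ (n + 1) / ((n + 1) * ((n + 1).factorial : ℝ))

lemma EinT_term_le (n : ℕ) (y : ℝ) :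
    ‖y ^ (n + 1) / ((n + 1) * ((n + 1).factorial : ℝ))‖ ≤ |y| ^ (n + 1) / ((n + 1).factorial : ℝ) := by
  rw [norm_div, norm_pow, Real.norm_eq_abs, Real.norm_of_nonneg (by positivity)]
  have h1 : (0 : ℝ) < ((n + 1).factorial : ℝ) := by positivity
  apply div_le_div_of_nonneg_left (by positivity) h1
  have : (0 : ℝ) ≤ n := by positivity
  nlinarith

lemma EinT_summable (y : ℝ) :
    Summable (fun n : ℕ => y ^ (n + 1) / ((n + 1) * ((n + 1).factorial : ℝ))) := by
  refine Summable.of_norm_bounded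
    (g := fun n : ℕ => |y| ^ (n + 1) / ((n + 1).factorial : ℝ)) ?_ (fun n => EinT_term_le n y)
  exact (summable_nat_add_iff 1).2 (Real.summable_pow_div_factorial |y|)

lemma EinT_hasDerivAt (y : ℝ) (hy : y ≠ 0) : HasDerivAt EinT ((Real.exp y - 1) / y) y := by
  have key : HasDerivAt EinT (∑' n : ℕ, y ^ n / ((n + 1).factorial : ℝ)) y := by
    unfold EinT
    refine hasDerivAt_tsum_of_isPreconnected
      (g := fun (n : ℕ) (y : ℝ) => y ^ (n + 1) / ((n + 1) * ((n + 1).factorial : ℝ)))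
      (g' := fun (n : ℕ) (y : ℝ) => y ^ n / ((n + 1).factorial : ℝ))
      (u := fun n : ℕ => (|y| + 1) ^ n / (n.factorial : ℝ)) (t := Metric.ball 0 (|y| + 1)) (y₀ := y)
      (Real.summable_pow_div_factorial _) Metric.isOpen_ball
      (convex_ball _ _).isPreconnected ?_ ?_ (by simp) (EinT_summable y) (by simp)
    · intro n x _
      have h := (hasDerivAt_pow (n + 1) x).div_const ((n + 1) * ((n + 1).factorial : ℝ))
      refine h.congr_deriv ?_
      have h1 : ((n + 1).factorial : ℝ) ≠ 0 := by positivity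
      have h2 : (n + 1 : ℝ) ≠ 0 := by positivity
      push_cast
      rw [mul_div_mul_left _ _ h2]
    · intro n x hx
      have hx' : |x| ≤ |y| + 1 := by simpa using (mem_ball_zero_iff.1 hx).le
      rw [norm_div, norm_pow, Real.norm_eq_abs, Real.norm_of_nonneg (by positivity)]
      have : (n.factorial : ℝ) ≤ (n + 1).factorial := by
        exact_mod_cast Nat.factorial_le (Nat.le_succ n)
      gcongr
  convert key using 1
  have h := NormedSpace.expSeries_div_hasSum_exp y
  rw [← Real.exp_eq_exp_ℝ] at h
  have h' := (hasSum_nat_add_iff' 1).2 h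
  simp only [Finset.range_one, Finset.sum_singleton, pow_zero, Nat.factorial_zero, Nat.cast_one,
    div_one] at h'
  have h'' := h'.div_const y
  rw [← h''.tsum_eq]
  congr 1
  ext n
  rw [pow_succ]
  field_simp

lemma EinT_zero : EinT 0 = 0 := by simp [EinT]

lemma EinT_continuous : Continuous EinT := by
  rw [continuous_iff_continuousAt]
  intro y
  have : ContinuousOn EinT (Metric.ball 0 (|y| + 1)) := by
    unfold EinT
    refine continuousOn_tsum
      (u := fun n : ℕ => (|y| + 1) ^ (n + 1) / ((n + 1).factorial : ℝ)) (by fun_prop)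
      ((summable_nat_add_iff 1).2 (Real.summable_pow_div_factorial (|y| + 1))) ?_
    intro n x hx
    have hx' : |x| ≤ |y| + 1 := by simpa using (mem_ball_zero_iff.1 hx).le
    refine (EinT_term_le n x).trans ?_
    gcongr
  exact this.continuousAt (Metric.isOpen_ball.mem_nhds (by simp))

lemma integral_log_exp :
    ∫ t in Set.Ioi (0 : ℝ), Real.log t * Real.exp (-t) = -Real.eulerMascheroniConstant := by
  have h1 := Complex.hasDerivAt_GammaIntegral (s := 1) (by simp)
  have h2 : HasDerivAt Complex.GammaIntegral (-(Real.eulerMascheroniConstant : ℂ)) 1 := by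
    refine Complex.hasDerivAt_Gamma_one.congr_of_eventuallyEq ?_
    have : {s : ℂ | 0 < s.re} ∈ 𝓝 (1 : ℂ) :=
      (isOpen_lt continuous_const Complex.continuous_re).mem_nhds (by simp)
    filter_upwards [this] with s hs
    exact (Complex.Gamma_eq_integral hs).symm
  have h3 := h1.unique h2
  simp only [sub_self, Complex.cpow_zero, one_mul] at h3
  have h4 : ∫ t in Set.Ioi (0 : ℝ), ((Real.log t : ℂ) * (Real.exp (-t) : ℂ)) =
      ((∫ t in Set.Ioi (0 : ℝ), Real.log t * Real.exp (-t) : ℝ) : ℂ) := by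
    rw [← integral_complex_ofReal]
    simp
  rw [h4] at h3
  exact_mod_cast h3

lemma integrableOn_log_exp :
    IntegrableOn (fun t : ℝ => Real.log t * Real.exp (-t)) (Set.Ioi (0 : ℝ)) := by
  by_contra h
  have h1 := integral_undef h
  rw [integral_log_exp] at h1
  have := Real.one_half_lt_eulerMascheroniConstant
  linarith

noncomputable def auxF (x : ℝ) : ℝ := Real.eulerMascheroniConstant + Real.log x + EinT (-x)

noncomputable def auxP (x : ℝ) : ℝ :=
  Real.exp (-x) * Real.log x + ∫ t in (0 : ℝ)..x, Real.log t * Real.exp (-t)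

lemma auxF_hasDerivAt (x : ℝ) (hx : 0 < x) : HasDerivAt auxF (Real.exp (-x) / x) x := by
  have h1 := (EinT_hasDerivAt (-x) (by linarith)).comp x (hasDerivAt_neg x)
  have h := ((Real.hasDerivAt_log hx.ne').const_add Real.eulerMascheroniConstant).add h1
  refine h.congr_deriv ?_
  field_simp
  ring

lemma ii_log_exp (x : ℝ) (hx : 0 ≤ x) :
    IntervalIntegrable (fun t : ℝ => Real.log t * Real.exp (-t)) volume 0 x := by
  rw [intervalIntegrable_iff_integrableOn_Ioc_of_le hx]
  exact integrableOn_log_exp.mono_set Set.Ioc_subset_Ioi_self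

lemma auxP_hasDerivAt (x : ℝ) (hx : 0 < x) : HasDerivAt auxP (Real.exp (-x) / x) x := by
  have h1 : HasDerivAt (fun x : ℝ => Real.exp (-x)) (-Real.exp (-x)) x := by
    simpa using (hasDerivAt_neg x).exp
  have h2 := h1.mul (Real.hasDerivAt_log hx.ne')
  have h3 := intervalIntegral.integral_hasDerivAt_right (ii_log_exp x hx.le)
    (Measurable.stronglyMeasurable (by fun_prop)).stronglyMeasurableAtFilter
    (ContinuousAt.mul (Real.continuousAt_log hx.ne') (by fun_prop))
  refine (h2.add h3).congr_deriv ?_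
  field_simp
  ring

lemma auxF_sub_auxP_tendsto :
    Tendsto (fun x => auxF x - auxP x) (𝓝[>] 0) (𝓝 Real.eulerMascheroniConstant) := by
  have h1 : Tendsto (fun x : ℝ => (1 - Real.exp (-x)) * Real.log x) (𝓝[>] 0) (𝓝 0) := by
    have h0 : Tendsto (fun x : ℝ => |x * Real.log x|) (𝓝[>] 0) (𝓝 0) := by
      have : Continuous (fun x : ℝ => |x * Real.log x|) := Real.continuous_mul_log.abs
      have := this.tendsto 0
      simp only [zero_mul, abs_zero] at this
      exact this.mono_left nhdsWithin_le_nhds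
    refine squeeze_zero_norm' ?_ h0
    filter_upwards [self_mem_nhdsWithin] with x hx
    have hx : 0 < x := hx
    rw [norm_mul, abs_mul, Real.norm_eq_abs, Real.norm_eq_abs]
    have h5 : Real.exp (-x) ≤ 1 := by simpa using hx.le
    have := Real.add_one_le_exp (-x)
    refine mul_le_mul_of_nonneg_right ?_ (abs_nonneg _)
    rw [abs_of_nonneg (by linarith), abs_of_pos hx]
    linarith
  have h2 : Tendsto (fun x : ℝ => EinT (-x)) (𝓝[>] 0) (𝓝 0) := by
    have := (EinT_continuous.comp continuous_neg).tendsto 0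
    simp only [Function.comp, neg_zero, EinT_zero] at this
    exact this.mono_left nhdsWithin_le_nhds
  have h3 : Tendsto (fun x : ℝ => ∫ t in (0 : ℝ)..x, Real.log t * Real.exp (-t))
      (𝓝[>] 0) (𝓝 0) := by
    have h := intervalIntegral.continuousOn_primitive_interval' (ii_log_exp 1 (by norm_num))
      Set.left_mem_uIcc
    have := h 0 Set.left_mem_uIcc
    rw [ContinuousWithinAt, intervalIntegral.integral_same, Set.uIcc_of_le (by norm_num)] at this
    refine this.mono_left ?_
    rw [← nhdsWithin_Ioc_eq_nhdsGT (show (0 : ℝ) < 1 by norm_num)]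
    exact nhdsWithin_mono _ Set.Ioc_subset_Icc_self
  have h := ((h1.add h2).sub h3).const_add Real.eulerMascheroniConstant
  simp only [add_zero, sub_zero] at h
  refine h.congr fun x => ?_
  simp only [auxF, auxP]
  ring

lemma auxF_eq (x : ℝ) (hx : 0 < x) : auxF x = auxP x + Real.eulerMascheroniConstant := by
  have hd : ∀ y ∈ Set.Ioi (0 : ℝ), HasDerivAt (fun x => auxF x - auxP x) 0 y := fun y hy => by
    exact ((auxF_hasDerivAt y hy).sub (auxP_hasDerivAt y hy)).congr_deriv (sub_self _)
  obtain ⟨a, ha⟩ := isOpen_Ioi.exists_is_const_of_deriv_eq_zero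
    (convex_Ioi (0 : ℝ)).isPreconnected
    (fun y hy => (hd y hy).differentiableAt.differentiableWithinAt) (fun y hy => (hd y hy).deriv)
  have h1 : Tendsto (fun x => auxF x - auxP x) (𝓝[>] 0) (𝓝 a) := by
    refine tendsto_const_nhds.congr' ?_
    filter_upwards [self_mem_nhdsWithin] with y hy
    exact (ha y hy).symm
  have h2 := tendsto_nhds_unique h1 auxF_sub_auxP_tendsto
  have := ha x hx
  linarith

lemma auxF_tendsto : Tendsto auxF atTop (𝓝 0) := by
  have h1 : Tendsto (fun x : ℝ => Real.exp (-x) * Real.log x) atTop (𝓝 0) := by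
    have h0 := Real.tendsto_pow_mul_exp_neg_atTop_nhds_zero 1
    refine squeeze_zero' ?_ ?_ h0
    · filter_upwards [eventually_ge_atTop 1] with x hx
      have := Real.log_nonneg hx
      positivity
    · filter_upwards [eventually_ge_atTop 1] with x hx
      have := Real.log_le_self (zero_le_one.trans hx)
      rw [pow_one, mul_comm]
      gcongr
  have h2 := intervalIntegral_tendsto_integral_Ioi 0 integrableOn_log_exp tendsto_id
  rw [integral_log_exp] at h2
  have h := (h1.add h2).add_const Real.eulerMascheroniConstant
  simp only [zero_add, neg_add_cancel] at h
  refine h.congr' ?_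
  filter_upwards [eventually_gt_atTop 0] with x hx
  rw [auxF_eq x hx]
  rfl

lemma EiNeg_eq (x : ℝ) (hx : 0 < x) : EiNeg x = auxF x := by
  have h := integral_Ioi_of_hasDerivAt_of_nonneg' (a := x)
    (fun y hy => auxF_hasDerivAt y (lt_of_lt_of_le hx hy))
    (fun y hy => by
      have : 0 < y := hx.trans hy
      positivity) auxF_tendsto
  rw [EiNeg, h]
  ring

lemma EiNeg_hasDerivAt (x : ℝ) (hx : 0 < x) : HasDerivAt EiNeg (Real.exp (-x) / x) x := by
  refine (auxF_hasDerivAt x hx).congr_of_eventuallyEq ?_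
  filter_upwards [lt_mem_nhds hx] with y hy using EiNeg_eq y hy

lemma EiPos_sub_hasSum (x : ℝ) (hx : 0 < x) :
    HasSum (fun m : ℕ => 2 * x ^ (2 * m + 1) /
      (((2 * m + 1 : ℕ) : ℝ) * ((2 * m + 1).factorial : ℝ))) (EiPos x - EiNeg x) := by
  have h1 := (EinT_summable x).hasSum.sub (EinT_summable (-x)).hasSum
  have h2 : EiPos x - EiNeg x = EinT x - EinT (-x) := by
    rw [EiNeg_eq x hx, auxF, EiPos, ← EinT]
    ring
  rw [h2]
  have hinj : Function.Injective (fun m : ℕ => 2 * m) := fun a b h => by simpa using h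
  have h3 := (hinj.hasSum_iff (a := EinT x - EinT (-x)) ?_).2 h1
  · convert h3 using 2 with m
    have ho : Odd (2 * m + 1) := ⟨m, rfl⟩
    simp only [Function.comp]
    rw [ho.neg_pow]
    push_cast
    ring
  · intro n hn
    have : Odd n := by
      rw [← Nat.not_even_iff_odd]
      rintro ⟨k, rfl⟩
      exact hn ⟨k, by simp; ring⟩
    have : Even (n + 1) := this.add_one
    rw [this.neg_pow, sub_self]

lemma anti_hasDerivAt (m : ℕ) (x : ℝ) :
    HasDerivAt (fun x : ℝ => -(Real.exp (-x) * ∑ l ∈ Finset.range (m + 1), x ^ l / (l.factorial : ℝ)))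
      (x ^ m * Real.exp (-x) / (m.factorial : ℝ)) x := by
  have h1 : HasDerivAt (fun x : ℝ => Real.exp (-x)) (-Real.exp (-x)) x := by
    simpa using (hasDerivAt_neg x).exp
  have h2 : HasDerivAt (fun x : ℝ => ∑ l ∈ Finset.range (m + 1), x ^ l / (l.factorial : ℝ))
      (∑ l ∈ Finset.range m, x ^ l / (l.factorial : ℝ)) x := by
    induction m with
    | zero => simpa using hasDerivAt_const x (1 : ℝ)
    | succ k ih =>
      simp_rw [Finset.sum_range_succ _ (k + 1)]
      rw [Finset.sum_range_succ _ k]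
      refine ih.add (((hasDerivAt_pow (k + 1) x).div_const _).congr_deriv ?_)
      rw [Nat.factorial_succ]
      push_cast
      try simp only [Nat.add_sub_cancel]
      field_simp
  refine (h1.mul h2).neg.congr_deriv ?_
  rw [Finset.sum_range_succ]
  ring

theorem stmt6 (u v : ℝ) (hu : 0 < u) (huv : u < v) :
    ∫ x in u..v, EiPos x * (Real.exp (-x) / x) =
      (1 / 2) * (EiNeg v ^ 2 - EiNeg u ^ 2)
        + ∑' m : ℕ, ∑ l ∈ Finset.range (2 * m + 1),
            2 * (u ^ l * Real.exp (-u) - v ^ l * Real.exp (-v)) /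
              (((2 * m + 1 : ℕ) : ℝ) ^ 2 * (l.factorial : ℝ)) := by
  have hpos : ∀ x ∈ Set.uIcc u v, 0 < x := fun x hx => by
    rw [Set.uIcc_of_le huv.le] at hx
    exact hu.trans_le hx.1
  have hcw : ContinuousOn (fun x : ℝ => Real.exp (-x) / x) (Set.uIcc u v) :=
    ContinuousOn.div (by fun_prop) continuousOn_id (fun x hx => (hpos x hx).ne')
  have hcN : ContinuousOn EiNeg (Set.uIcc u v) := fun x hx =>
    (EiNeg_hasDerivAt x (hpos x hx)).continuousAt.continuousWithinAt
  have hcP : ContinuousOn EiPos (Set.uIcc u v) := by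
    have : ContinuousOn (fun x => Real.eulerMascheroniConstant + Real.log x + EinT x)
        (Set.uIcc u v) :=
      (continuousOn_const.add (Real.continuousOn_log.mono fun x hx => (hpos x hx).ne')).add
        EinT_continuous.continuousOn
    exact this
  have hiN : IntervalIntegrable (fun x => EiNeg x * (Real.exp (-x) / x)) volume u v :=
    (hcN.mul hcw).intervalIntegrable
  have hiP : IntervalIntegrable (fun x => EiPos x * (Real.exp (-x) / x)) volume u v :=
    (hcP.mul hcw).intervalIntegrable
  have hN : ∫ x in u..v, EiNeg x * (Real.exp (-x) / x) =
      (1 / 2) * (EiNeg v ^ 2 - EiNeg u ^ 2) := by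
    rw [intervalIntegral.integral_eq_sub_of_hasDerivAt (f := fun x => (1 / 2) * EiNeg x ^ 2) _ hiN]
    · ring
    · intro x hx
      refine (((EiNeg_hasDerivAt x (hpos x hx)).pow 2).const_mul (1 / 2)).congr_deriv ?_
      simp only [Nat.cast_ofNat]
      ring
  have hS : HasSum (fun m : ℕ => ∫ x in u..v, (2 / ((2 * m + 1 : ℕ) : ℝ) ^ 2) *
      (x ^ (2 * m) * Real.exp (-x) / ((2 * m).factorial : ℝ)))
      (∫ x in u..v, (EiPos x * (Real.exp (-x) / x) - EiNeg x * (Real.exp (-x) / x))) := by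
    refine intervalIntegral.hasSum_integral_of_dominated_convergence
      (fun (m : ℕ) _ => 2 * (v ^ (2 * m) / ((2 * m).factorial : ℝ))) ?_ ?_ ?_ ?_ ?_
    · intro m
      exact (Continuous.aestronglyMeasurable (by fun_prop))
    · intro m
      refine Eventually.of_forall fun x hx => ?_
      rw [Set.uIoc_of_le huv.le] at hx
      have hx0 : 0 < x := hu.trans hx.1
      rw [Real.norm_of_nonneg (by positivity)]
      have h1 : (1 : ℝ) ≤ ((2 * m + 1 : ℕ) : ℝ) ^ 2 := by
        apply one_le_pow₀
        exact_mod_cast Nat.le_add_left 1 (2 * m)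
      have h2 : 2 / ((2 * m + 1 : ℕ) : ℝ) ^ 2 ≤ 2 := div_le_self (by norm_num) h1
      have h3 : x ^ (2 * m) * Real.exp (-x) ≤ v ^ (2 * m) := by
        have h4 : x ^ (2 * m) ≤ v ^ (2 * m) := pow_le_pow_left₀ hx0.le hx.2 _
        have h5 : Real.exp (-x) ≤ 1 := by simpa using hx0.le
        exact (mul_le_of_le_one_right (by positivity) h5).trans h4
      gcongr
    · refine Eventually.of_forall fun x _ => ?_
      have hinj : Function.Injective (fun m : ℕ => 2 * m) := fun a b h => by simpa using h
      exact ((Real.summable_pow_div_factorial v).comp_injective hinj).mul_left 2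
    · exact intervalIntegrable_const
    · refine Eventually.of_forall fun x hx => ?_
      rw [Set.uIoc_of_le huv.le] at hx
      have hx0 : 0 < x := hu.trans hx.1
      have h := (EiPos_sub_hasSum x hx0).mul_right (Real.exp (-x) / x)
      rw [sub_mul] at h
      refine (congrArg (fun f : ℕ → ℝ => HasSum f _) (funext fun m => ?_)).mpr h
      rw [Nat.factorial_succ]
      push_cast
      field_simp
      try ring
  rw [intervalIntegral.integral_sub hiP hiN, hN] at hS
  have hE := hS.tsum_eq
  rw [← sub_eq_iff_eq_add', ← hE]
  congr 1
  ext m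
  rw [intervalIntegral.integral_const_mul,
    intervalIntegral.integral_eq_sub_of_hasDerivAt (fun x _ => anti_hasDerivAt (2 * m) x)
      (Continuous.intervalIntegrable (by fun_prop) _ _)]
  rw [neg_sub_neg, Finset.mul_sum, Finset.mul_sum, ← Finset.sum_sub_distrib, Finset.mul_sum]
  refine Finset.sum_congr rfl fun l _ => ?_
  field_simp
end
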